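/- Let k be a field and H a coquasi-bialgebra over k with preantipode S. Then for every h ∈ H one has ∑ ω⁻¹(S(h₁) ⊗ h₂ ⊗ S(h₃)) = ε(S(h)), where ω⁻¹ is the convolution inverse of the reassociator ω. -/

import Mathlib

open scoped TensorProduct
open TensorProduct

/-- A coquasi-bialgebra structure on a coassociative counital `k`-coalgebra `H`:
a multiplication `mul` (a coalgebra morphism, given in curried bilinear form), a unit `one`,
and a convolution-invertible trilinear reassociator `ω` (with convolution inverse `ωInv`),
subject to the cocycle condition, unitality, and quasi-associativity.
Sweedler-type identities are stated for arbitrary finite representations of the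
comultiplications involved. -/
structure CoquasiBialgebra (k H : Type*) [CommRing k] [AddCommGroup H] [Module k H]
    [Coalgebra k H] where
  mul : H →ₗ[k] H →ₗ[k] H
  one : H
  ω : H →ₗ[k] H →ₗ[k] H →ₗ[k] k
  ωInv : H →ₗ[k] H →ₗ[k] H →ₗ[k] k
  /-- `mul` is comultiplicative: `Δ(xy) = ∑ x₁y₁ ⊗ x₂y₂`. -/
  comul_mul : ∀ (x y : H) (n m : ℕ) (x1 x2 : Fin n → H) (y1 y2 : Fin m → H),
    Coalgebra.comul (R := k) x = ∑ i, x1 i ⊗ₜ[k] x2 i →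
    Coalgebra.comul (R := k) y = ∑ j, y1 j ⊗ₜ[k] y2 j →
    Coalgebra.comul (R := k) (mul x y) =
      ∑ i, ∑ j, mul (x1 i) (y1 j) ⊗ₜ[k] mul (x2 i) (y2 j)
  counit_mul : ∀ x y, Coalgebra.counit (R := k) (mul x y) =
      Coalgebra.counit (R := k) x * Coalgebra.counit (R := k) y
  comul_one : Coalgebra.comul (R := k) one = one ⊗ₜ[k] one
  counit_one : Coalgebra.counit (R := k) one = 1
  one_mul : ∀ h, mul one h = h
  mul_one : ∀ h, mul h one = h
  /-- `ω(x ⊗ 1 ⊗ y) = ε(x)ε(y)`. -/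
  ω_one : ∀ x y, ω x one y = Coalgebra.counit (R := k) x * Coalgebra.counit (R := k) y
  /-- `ωInv` is the two-sided convolution inverse of `ω`. -/
  ω_conv_inv : ∀ (x y z : H) (n m p : ℕ) (x1 x2 : Fin n → H) (y1 y2 : Fin m → H)
    (z1 z2 : Fin p → H),
    Coalgebra.comul (R := k) x = ∑ i, x1 i ⊗ₜ[k] x2 i →
    Coalgebra.comul (R := k) y = ∑ j, y1 j ⊗ₜ[k] y2 j →
    Coalgebra.comul (R := k) z = ∑ l, z1 l ⊗ₜ[k] z2 l →
    (∑ i, ∑ j, ∑ l, ω (x1 i) (y1 j) (z1 l) * ωInv (x2 i) (y2 j) (z2 l) =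
      Coalgebra.counit (R := k) x * Coalgebra.counit (R := k) y *
        Coalgebra.counit (R := k) z) ∧
    (∑ i, ∑ j, ∑ l, ωInv (x1 i) (y1 j) (z1 l) * ω (x2 i) (y2 j) (z2 l) =
      Coalgebra.counit (R := k) x * Coalgebra.counit (R := k) y *
        Coalgebra.counit (R := k) z)
  /-- The 3-cocycle condition:
  `∑ ω(x₁ ⊗ y₁ ⊗ z₁w₁) ω(x₂y₂ ⊗ z₂ ⊗ w₂)
    = ∑ ω(y₁ ⊗ z₁ ⊗ w₁) ω(x₁ ⊗ y₂z₂ ⊗ w₂) ω(x₂ ⊗ y₃ ⊗ z₃)`. -/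
  cocycle : ∀ (x y z w : H) (nx ny nz nw : ℕ)
    (x1 x2 : Fin nx → H) (y1 y2 : Fin ny → H) (z1 z2 : Fin nz → H) (w1 w2 : Fin nw → H)
    (my : Fin ny → ℕ) (y21 y22 : ∀ j, Fin (my j) → H)
    (mz : Fin nz → ℕ) (z21 z22 : ∀ l, Fin (mz l) → H),
    Coalgebra.comul (R := k) x = ∑ i, x1 i ⊗ₜ[k] x2 i →
    Coalgebra.comul (R := k) y = ∑ j, y1 j ⊗ₜ[k] y2 j →
    Coalgebra.comul (R := k) z = ∑ l, z1 l ⊗ₜ[k] z2 l →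
    Coalgebra.comul (R := k) w = ∑ r, w1 r ⊗ₜ[k] w2 r →
    (∀ j, Coalgebra.comul (R := k) (y2 j) = ∑ p, y21 j p ⊗ₜ[k] y22 j p) →
    (∀ l, Coalgebra.comul (R := k) (z2 l) = ∑ q, z21 l q ⊗ₜ[k] z22 l q) →
    ∑ i, ∑ j, ∑ l, ∑ r,
        ω (x1 i) (y1 j) (mul (z1 l) (w1 r)) * ω (mul (x2 i) (y2 j)) (z2 l) (w2 r) =
      ∑ i, ∑ j, ∑ p, ∑ l, ∑ q, ∑ r,
        ω (y1 j) (z1 l) (w1 r) * ω (x1 i) (mul (y21 j p) (z21 l q)) (w2 r) *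
          ω (x2 i) (y22 j p) (z22 l q)
  /-- Quasi-associativity: `∑ x₁(y₁z₁) ω(x₂ ⊗ y₂ ⊗ z₂) = ∑ ω(x₁ ⊗ y₁ ⊗ z₁) (x₂y₂)z₂`. -/
  quasi_assoc : ∀ (x y z : H) (n m p : ℕ) (x1 x2 : Fin n → H) (y1 y2 : Fin m → H)
    (z1 z2 : Fin p → H),
    Coalgebra.comul (R := k) x = ∑ i, x1 i ⊗ₜ[k] x2 i →
    Coalgebra.comul (R := k) y = ∑ j, y1 j ⊗ₜ[k] y2 j →
    Coalgebra.comul (R := k) z = ∑ l, z1 l ⊗ₜ[k] z2 l →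
    ∑ i, ∑ j, ∑ l, ω (x2 i) (y2 j) (z2 l) • mul (x1 i) (mul (y1 j) (z1 l)) =
      ∑ i, ∑ j, ∑ l, ω (x1 i) (y1 j) (z1 l) • mul (mul (x2 i) (y2 j)) (z2 l)

/-- A preantipode for a coquasi-bialgebra: a `k`-linear endomorphism `S` with
(P1) `∑ S(h₁)₁h₂ ⊗ S(h₁)₂ = 1 ⊗ S(h)`, (P2) `∑ S(h₂)₁ ⊗ h₁S(h₂)₂ = S(h) ⊗ 1`,
(P3) `∑ ω(h₁ ⊗ S(h₂) ⊗ h₃) = ε(h)`. -/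
def CoquasiBialgebra.IsPreantipode {k H : Type*} [CommRing k] [AddCommGroup H] [Module k H]
    [Coalgebra k H] (B : CoquasiBialgebra k H) (S : H →ₗ[k] H) : Prop :=
  (∀ (h : H) (n : ℕ) (a b : Fin n → H) (m : Fin n → ℕ) (c d : ∀ i, Fin (m i) → H),
    Coalgebra.comul (R := k) h = ∑ i, a i ⊗ₜ[k] b i →
    (∀ i, Coalgebra.comul (R := k) (S (a i)) = ∑ p, c i p ⊗ₜ[k] d i p) →
    ∑ i, ∑ p, B.mul (c i p) (b i) ⊗ₜ[k] d i p = B.one ⊗ₜ[k] S h) ∧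
  (∀ (h : H) (n : ℕ) (a b : Fin n → H) (m : Fin n → ℕ) (c d : ∀ i, Fin (m i) → H),
    Coalgebra.comul (R := k) h = ∑ i, a i ⊗ₜ[k] b i →
    (∀ i, Coalgebra.comul (R := k) (S (b i)) = ∑ p, c i p ⊗ₜ[k] d i p) →
    ∑ i, ∑ p, c i p ⊗ₜ[k] B.mul (a i) (d i p) = S h ⊗ₜ[k] B.one) ∧
  (∀ (h : H) (n : ℕ) (a b : Fin n → H) (m : Fin n → ℕ) (c d : ∀ i, Fin (m i) → H),
    Coalgebra.comul (R := k) h = ∑ i, a i ⊗ₜ[k] b i →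
    (∀ i, Coalgebra.comul (R := k) (b i) = ∑ p, c i p ⊗ₜ[k] d i p) →
    ∑ i, ∑ p, B.ω (a i) (S (c i p)) (d i p) = Coalgebra.counit (R := k) h)

namespace CoquasiBialgebra

open Coalgebra LinearMap WithConv

section Trilinear

variable {k H : Type*} [CommRing k] [AddCommGroup H] [Module k H]

/-- The functional `x ⊗ (y ⊗ z) ↦ φ x y z`. -/
noncomputable def triR (φ : H →ₗ[k] H →ₗ[k] H →ₗ[k] k) : H ⊗[k] (H ⊗[k] H) →ₗ[k] k :=
  lift (TensorProduct.uncurry (.id k) H H k ∘ₗ φ)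

/-- The functional `(x ⊗ y) ⊗ z ↦ φ x y z`. -/
noncomputable def triL (φ : H →ₗ[k] H →ₗ[k] H →ₗ[k] k) : (H ⊗[k] H) ⊗[k] H →ₗ[k] k :=
  lift (lift φ)

@[simp] lemma triR_tmul (φ : H →ₗ[k] H →ₗ[k] H →ₗ[k] k) (x y z : H) :
    triR φ (x ⊗ₜ (y ⊗ₜ z)) = φ x y z := by
  simp [triR]

@[simp] lemma triL_tmul (φ : H →ₗ[k] H →ₗ[k] H →ₗ[k] k) (x y z : H) :
    triL φ ((x ⊗ₜ y) ⊗ₜ z) = φ x y z := by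
  simp [triL]

/-- The element `(x ⊗ y) ⊗ (z ⊗ w)` as a linear function of `y ⊗ z`. -/
noncomputable def tmulMid (x w : H) : H ⊗[k] H →ₗ[k] (H ⊗[k] H) ⊗[k] (H ⊗[k] H) :=
  (TensorProduct.assoc k H H (H ⊗[k] H)).symm.toLinearMap ∘ₗ
    TensorProduct.mk k H (H ⊗[k] (H ⊗[k] H)) x ∘ₗ (TensorProduct.assoc k H H H).toLinearMap ∘ₗ
      (TensorProduct.mk k (H ⊗[k] H) H).flip w

@[simp] lemma tmulMid_tmul (x y z w : H) :
    tmulMid (k := k) x w (y ⊗ₜ z) = (x ⊗ₜ y) ⊗ₜ (z ⊗ₜ w) := by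
  simp [tmulMid]

end Trilinear

section Coalgebra

variable {k C D : Type*} [CommRing k] [AddCommGroup C] [Module k C] [Coalgebra k C]
  [AddCommGroup D] [Module k D] [Coalgebra k D]
  {ι κ : Type*} [Fintype ι] [Fintype κ]

lemma sum_counit_smul_right {x : C} {x1 x2 : ι → C}
    (hx : comul (R := k) x = ∑ i, x1 i ⊗ₜ[k] x2 i) :
    ∑ i, counit (R := k) (x1 i) • x2 i = x := by
  simpa [hx] using congr(TensorProduct.lid k C $(rTensor_counit_comul (R := k) x))

lemma sum_counit_smul_left {x : C} {x1 x2 : ι → C}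
    (hx : comul (R := k) x = ∑ i, x1 i ⊗ₜ[k] x2 i) :
    ∑ i, counit (R := k) (x2 i) • x1 i = x := by
  simpa [hx] using congr(TensorProduct.rid k C $(lTensor_counit_comul (R := k) x))

lemma comul_tmul_eq_sum {x : C} {y : D} {x1 x2 : ι → C} {y1 y2 : κ → D}
    (hx : comul (R := k) x = ∑ i, x1 i ⊗ₜ[k] x2 i)
    (hy : comul (R := k) y = ∑ j, y1 j ⊗ₜ[k] y2 j) :
    comul (R := k) (x ⊗ₜ[k] y) =
      ∑ p : ι × κ, (x1 p.1 ⊗ₜ[k] y1 p.2) ⊗ₜ[k] (x2 p.1 ⊗ₜ[k] y2 p.2) := by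
  simp only [comul_tmul, hx, hy, TensorProduct.sum_tmul, TensorProduct.tmul_sum, map_sum,
    AlgebraTensorModule.tensorTensorTensorComm_tmul, Fintype.sum_prod_type_right]

lemma convMul_apply_eq_sum (f g : WithConv (C →ₗ[k] k)) {x : C} {x1 x2 : ι → C}
    (hx : comul (R := k) x = ∑ i, x1 i ⊗ₜ[k] x2 i) :
    (f * g) x = ∑ i, f (x1 i) * g (x2 i) := by
  simp [hx]

lemma convMul_tmul_tmul {H : Type*} [AddCommGroup H] [Module k H] [Coalgebra k H]
    (f g : WithConv ((H ⊗[k] H) ⊗[k] (H ⊗[k] H) →ₗ[k] k)) {x y z w : H} {nx ny nz nw : ℕ}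
    {x1 x2 : Fin nx → H} {y1 y2 : Fin ny → H} {z1 z2 : Fin nz → H} {w1 w2 : Fin nw → H}
    (hx : comul (R := k) x = ∑ i, x1 i ⊗ₜ[k] x2 i)
    (hy : comul (R := k) y = ∑ j, y1 j ⊗ₜ[k] y2 j)
    (hz : comul (R := k) z = ∑ l, z1 l ⊗ₜ[k] z2 l)
    (hw : comul (R := k) w = ∑ r, w1 r ⊗ₜ[k] w2 r) :
    (f * g) ((x ⊗ₜ y) ⊗ₜ (z ⊗ₜ w)) = ∑ i, ∑ j, ∑ l, ∑ r,
      f ((x1 i ⊗ₜ y1 j) ⊗ₜ (z1 l ⊗ₜ w1 r)) * g ((x2 i ⊗ₜ y2 j) ⊗ₜ (z2 l ⊗ₜ w2 r)) := by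
  rw [convMul_apply_eq_sum f g (comul_tmul_eq_sum (comul_tmul_eq_sum hx hy)
    (comul_tmul_eq_sum hz hw))]
  simp only [Fintype.sum_prod_type]

end Coalgebra

section

variable {k H : Type*} [CommRing k] [AddCommGroup H] [Module k H] [Coalgebra k H]
  (B : CoquasiBialgebra k H)

lemma ω_one_left (y z : H) :
    B.ω B.one y z = counit (R := k) y * counit (R := k) z := by
  let e : WithConv (H ⊗[k] H →ₗ[k] k) := toConv (lift (B.ω B.one))
  let e' : WithConv (H ⊗[k] H →ₗ[k] k) := toConv (lift (B.ωInv B.one))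
  have hone : comul (R := k) B.one = ∑ i : Fin 1, B.one ⊗ₜ[k] B.one := by
    simp [B.comul_one]
  have hinv : e * e' = 1 := by
    ext y z
    obtain ⟨ny, y1, y2, hy⟩ := exists_sum_tmul_eq (comul (R := k) y)
    obtain ⟨nz, z1, z2, hz⟩ := exists_sum_tmul_eq (comul (R := k) z)
    have h := (B.ω_conv_inv B.one y z _ _ _ _ _ _ _ _ _ hone hy hz).1
    have h' := convMul_apply_eq_sum e e' (comul_tmul_eq_sum hy hz)
    simp only [Fintype.sum_prod_type] at h'
    simpa [B.counit_one, mul_comm] using h'.trans (by simpa [e, e', B.counit_one] using h)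
  have hidem : e * e = e := by
    ext y z
    obtain ⟨ny, y1, y2, hy⟩ := exists_sum_tmul_eq (comul (R := k) y)
    obtain ⟨nz, z1, z2, hz⟩ := exists_sum_tmul_eq (comul (R := k) z)
    choose my y21 y22 hy2 using fun j => exists_sum_tmul_eq (comul (R := k) (y2 j))
    have h := B.cocycle B.one B.one y z _ _ _ _ _ _ _ _ _ _ _ _ _ _ _ _ y21 y22
      hone hone hy hz (fun _ => hone) hy2
    simp only [B.one_mul, B.ω_one, B.counit_one, B.counit_mul, Finset.univ_unique,
      Finset.sum_const, Finset.card_singleton, one_smul, _root_.one_mul] at h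
    have hleft : ∑ j, ∑ l, counit (R := k) (y1 j) * counit (R := k) (z1 l) *
        B.ω B.one (y2 j) (z2 l) = B.ω B.one y z := by
      conv_rhs => rw [← sum_counit_smul_right hy, ← sum_counit_smul_right hz]
      simp only [map_sum, map_smul, LinearMap.sum_apply, LinearMap.smul_apply, smul_eq_mul,
        Finset.mul_sum]
      rw [Finset.sum_comm]
      exact Fintype.sum_congr _ _ fun l => Fintype.sum_congr _ _ fun j => by ring
    have hright : ∀ j l, ∑ p, B.ω B.one (y1 j) (z1 l) * B.ω B.one (y21 j p) (z2 l) *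
        counit (R := k) (y22 j p) = B.ω B.one (y1 j) (z1 l) * B.ω B.one (y2 j) (z2 l) := by
      intro j l
      conv_rhs => rw [← sum_counit_smul_left (hy2 j)]
      simp only [map_sum, map_smul, LinearMap.sum_apply, LinearMap.smul_apply,
        smul_eq_mul, Finset.mul_sum]
      exact Fintype.sum_congr _ _ fun p => by ring
    refine (convMul_apply_eq_sum e e (comul_tmul_eq_sum hy hz)).trans ?_
    rw [hleft] at h
    simp only [AlgebraTensorModule.curry_apply, TensorProduct.curry_apply, e, lift.tmul, h,
      Fintype.sum_prod_type, LinearMap.restrictScalars_self]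
    refine Fintype.sum_congr _ _ fun j => ?_
    rw [Finset.sum_comm]
    exact Fintype.sum_congr _ _ fun l => (hright j l).symm
  have he : e = 1 := by
    calc e = e * e * e' := by rw [mul_assoc, hinv, _root_.mul_one]
      _ = 1 := by rw [hidem, hinv]
  simpa [e, mul_comm] using congr($he (y ⊗ₜ z))

lemma ω_one_right (x y : H) :
    B.ω x y B.one = counit (R := k) x * counit (R := k) y := by
  let e : WithConv (H ⊗[k] H →ₗ[k] k) :=
    toConv (triL B.ω ∘ₗ (TensorProduct.mk k (H ⊗[k] H) H).flip B.one)
  let e' : WithConv (H ⊗[k] H →ₗ[k] k) :=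
    toConv (triL B.ωInv ∘ₗ (TensorProduct.mk k (H ⊗[k] H) H).flip B.one)
  have hone : comul (R := k) B.one = ∑ i : Fin 1, B.one ⊗ₜ[k] B.one := by
    simp [B.comul_one]
  have hinv : e * e' = 1 := by
    ext x y
    obtain ⟨nx, x1, x2, hx⟩ := exists_sum_tmul_eq (comul (R := k) x)
    obtain ⟨ny, y1, y2, hy⟩ := exists_sum_tmul_eq (comul (R := k) y)
    have h := (B.ω_conv_inv x y B.one _ _ _ _ _ _ _ _ _ hx hy hone).1
    have h' := convMul_apply_eq_sum e e' (comul_tmul_eq_sum hx hy)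
    simp only [Fintype.sum_prod_type] at h'
    simpa [B.counit_one, mul_comm] using h'.trans (by simpa [e, e', B.counit_one] using h)
  have hidem : e * e = e := by
    ext x y
    obtain ⟨nx, x1, x2, hx⟩ := exists_sum_tmul_eq (comul (R := k) x)
    obtain ⟨ny, y1, y2, hy⟩ := exists_sum_tmul_eq (comul (R := k) y)
    choose my y21 y22 hy2 using fun j => exists_sum_tmul_eq (comul (R := k) (y2 j))
    have h := B.cocycle x y B.one B.one _ _ _ _ _ _ _ _ _ _ _ _ _ y21 y22 _ _ _
      hx hy hone hone hy2 (fun _ => hone)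
    simp only [B.mul_one, B.ω_one, B.counit_one, B.counit_mul, Finset.univ_unique,
      Finset.sum_const, Finset.card_singleton, one_smul, _root_.mul_one] at h
    have hleft : ∑ i, ∑ j, B.ω (x1 i) (y1 j) B.one *
        (counit (R := k) (x2 i) * counit (R := k) (y2 j)) = B.ω x y B.one := by
      conv_rhs => rw [← sum_counit_smul_left hx, ← sum_counit_smul_left hy]
      simp only [map_sum, map_smul, LinearMap.sum_apply, LinearMap.smul_apply,
        smul_eq_mul, Finset.mul_sum]
      rw [Finset.sum_comm]
      exact Fintype.sum_congr _ _ fun j => Fintype.sum_congr _ _ fun i => by ring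
    have hinner : ∀ j, (e * e).ofConv (x ⊗ₜ[k] y2 j) =
        ∑ i, ∑ p, B.ω (x1 i) (y21 j p) B.one * B.ω (x2 i) (y22 j p) B.one := fun j => by
      rw [convMul_apply_eq_sum e e (comul_tmul_eq_sum hx (hy2 j))]
      simp [Fintype.sum_prod_type, e]
    have hright : (e * e).ofConv (x ⊗ₜ[k] y) = B.ω x y B.one := by
      rw [← hleft, h]
      conv_lhs => rw [← sum_counit_smul_right hy]
      simp only [tmul_sum, tmul_smul, map_sum, map_smul, hinner, smul_eq_mul, Finset.mul_sum]
      rw [Finset.sum_comm]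
      exact Fintype.sum_congr _ _ fun i => Fintype.sum_congr _ _ fun j =>
        Fintype.sum_congr _ _ fun p => by ring
    simpa [e] using hright
  have he : e = 1 := by
    calc e = e * e * e' := by rw [mul_assoc, hinv, _root_.mul_one]
      _ = 1 := by rw [hidem, hinv]
  simpa [e, mul_comm] using congr($he (x ⊗ₜ y))

/-- The multiplication as a linear map on `H ⊗ H`. -/
noncomputable def mulT : H ⊗[k] H →ₗ[k] H := lift B.mul

@[simp] lemma mulT_tmul (x y : H) : B.mulT (x ⊗ₜ y) = B.mul x y := by simp [mulT]

/-- The functional `(x ⊗ y) ⊗ (z ⊗ w) ↦ ω(x ⊗ y ⊗ zw)`. -/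
noncomputable def ωMulRight : WithConv ((H ⊗[k] H) ⊗[k] (H ⊗[k] H) →ₗ[k] k) :=
  toConv (triL B.ω ∘ₗ lTensor (H ⊗[k] H) B.mulT)

/-- The functional `(x ⊗ y) ⊗ (z ⊗ w) ↦ ω(xy ⊗ z ⊗ w)`. -/
noncomputable def ωMulLeft : WithConv ((H ⊗[k] H) ⊗[k] (H ⊗[k] H) →ₗ[k] k) :=
  toConv (triR B.ω ∘ₗ rTensor (H ⊗[k] H) B.mulT)

/-- The functional `(x ⊗ y) ⊗ (z ⊗ w) ↦ ω(x ⊗ yz ⊗ w)`. -/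
noncomputable def ωMulMid : WithConv ((H ⊗[k] H) ⊗[k] (H ⊗[k] H) →ₗ[k] k) :=
  toConv (triR B.ω ∘ₗ
    lTensor H (rTensor H B.mulT ∘ₗ (TensorProduct.assoc k H H H).symm.toLinearMap) ∘ₗ
    (TensorProduct.assoc k H H (H ⊗[k] H)).toLinearMap)

/-- The functional `(x ⊗ y) ⊗ (z ⊗ w) ↦ φ(x ⊗ y ⊗ z)ε(w)`. -/
noncomputable def tmulCounit (φ : H →ₗ[k] H →ₗ[k] H →ₗ[k] k) :
    WithConv ((H ⊗[k] H) ⊗[k] (H ⊗[k] H) →ₗ[k] k) :=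
  toConv (mul' k k ∘ₗ TensorProduct.map (triL φ) counit ∘ₗ
    (TensorProduct.assoc k (H ⊗[k] H) H H).symm.toLinearMap)

/-- The functional `(x ⊗ y) ⊗ (z ⊗ w) ↦ ε(x)φ(y ⊗ z ⊗ w)`. -/
noncomputable def counitTmul (φ : H →ₗ[k] H →ₗ[k] H →ₗ[k] k) :
    WithConv ((H ⊗[k] H) ⊗[k] (H ⊗[k] H) →ₗ[k] k) :=
  toConv (mul' k k ∘ₗ TensorProduct.map counit (triR φ) ∘ₗ
    (TensorProduct.assoc k H H (H ⊗[k] H)).toLinearMap)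

section
variable (φ : H →ₗ[k] H →ₗ[k] H →ₗ[k] k) (x y z w : H)

@[simp] lemma ωMulRight_tmul :
    B.ωMulRight.ofConv ((x ⊗ₜ y) ⊗ₜ (z ⊗ₜ w)) = B.ω x y (B.mul z w) := by
  simp [ωMulRight]

@[simp] lemma ωMulLeft_tmul :
    B.ωMulLeft.ofConv ((x ⊗ₜ y) ⊗ₜ (z ⊗ₜ w)) = B.ω (B.mul x y) z w := by
  simp [ωMulLeft]

@[simp] lemma ωMulMid_tmul :
    B.ωMulMid.ofConv ((x ⊗ₜ y) ⊗ₜ (z ⊗ₜ w)) = B.ω x (B.mul y z) w := by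
  simp [ωMulMid]

@[simp] lemma tmulCounit_tmul :
    (tmulCounit φ).ofConv ((x ⊗ₜ y) ⊗ₜ (z ⊗ₜ w)) = φ x y z * counit (R := k) w := by
  simp [tmulCounit]

@[simp] lemma counitTmul_tmul :
    (counitTmul φ).ofConv ((x ⊗ₜ y) ⊗ₜ (z ⊗ₜ w)) = counit (R := k) x * φ y z w := by
  simp [counitTmul]

end

lemma tmulCounit_mul_tmulCounit_ωInv : tmulCounit B.ω * tmulCounit B.ωInv = 1 := by
  ext x y z w
  obtain ⟨nx, x1, x2, hx⟩ := exists_sum_tmul_eq (comul (R := k) x)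
  obtain ⟨ny, y1, y2, hy⟩ := exists_sum_tmul_eq (comul (R := k) y)
  obtain ⟨nz, z1, z2, hz⟩ := exists_sum_tmul_eq (comul (R := k) z)
  obtain ⟨nw, w1, w2, hw⟩ := exists_sum_tmul_eq (comul (R := k) w)
  have h := (B.ω_conv_inv x y z _ _ _ _ _ _ _ _ _ hx hy hz).1
  have h' := convMul_tmul_tmul (tmulCounit B.ω) (tmulCounit B.ωInv) hx hy hz hw
  have hw' : ∑ r, counit (R := k) (w1 r) * counit (R := k) (w2 r) = counit (R := k) w := by
    simpa using congr(counit (R := k) $(sum_counit_smul_right hw))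
  refine h'.trans ?_
  have hsplit : ∀ i j l, ∑ r, (tmulCounit B.ω).ofConv ((x1 i ⊗ₜ y1 j) ⊗ₜ (z1 l ⊗ₜ w1 r)) *
      (tmulCounit B.ωInv).ofConv ((x2 i ⊗ₜ y2 j) ⊗ₜ (z2 l ⊗ₜ w2 r)) =
      B.ω (x1 i) (y1 j) (z1 l) * B.ωInv (x2 i) (y2 j) (z2 l) * counit (R := k) w := fun i j l => by
    simp only [tmulCounit_tmul, ← hw', Finset.mul_sum, mul_mul_mul_comm]
  simp only [hsplit, ← Finset.sum_mul, h]
  simp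
  ring

lemma convMul_tmulCounit (φ : H →ₗ[k] H →ₗ[k] H →ₗ[k] k)
    (f : WithConv ((H ⊗[k] H) ⊗[k] (H ⊗[k] H) →ₗ[k] k)) {x y z : H} (w : H) {nx ny nz : ℕ}
    {x1 x2 : Fin nx → H} {y1 y2 : Fin ny → H} {z1 z2 : Fin nz → H}
    (hx : comul (R := k) x = ∑ i, x1 i ⊗ₜ[k] x2 i)
    (hy : comul (R := k) y = ∑ j, y1 j ⊗ₜ[k] y2 j)
    (hz : comul (R := k) z = ∑ l, z1 l ⊗ₜ[k] z2 l) :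
    (f * tmulCounit φ) ((x ⊗ₜ y) ⊗ₜ (z ⊗ₜ w)) = ∑ i, ∑ j, ∑ l,
      f ((x1 i ⊗ₜ y1 j) ⊗ₜ (z1 l ⊗ₜ w)) * φ (x2 i) (y2 j) (z2 l) := by
  obtain ⟨nw, w1, w2, hw⟩ := exists_sum_tmul_eq (comul (R := k) w)
  rw [convMul_tmul_tmul _ _ hx hy hz hw]
  refine Fintype.sum_congr _ _ fun i => Fintype.sum_congr _ _ fun j =>
    Fintype.sum_congr _ _ fun l => ?_
  conv_rhs => rw [← sum_counit_smul_left hw]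
  simp only [tmulCounit_tmul, TensorProduct.tmul_sum, TensorProduct.tmul_smul, map_sum, map_smul,
    smul_eq_mul, Finset.sum_mul]
  exact Fintype.sum_congr _ _ fun r => by ring

lemma counitTmul_convMul (φ : H →ₗ[k] H →ₗ[k] H →ₗ[k] k)
    (f : WithConv ((H ⊗[k] H) ⊗[k] (H ⊗[k] H) →ₗ[k] k)) (x : H) {y z w : H} {ny nz nw : ℕ}
    {y1 y2 : Fin ny → H} {z1 z2 : Fin nz → H} {w1 w2 : Fin nw → H}
    (hy : comul (R := k) y = ∑ j, y1 j ⊗ₜ[k] y2 j)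
    (hz : comul (R := k) z = ∑ l, z1 l ⊗ₜ[k] z2 l)
    (hw : comul (R := k) w = ∑ r, w1 r ⊗ₜ[k] w2 r) :
    (counitTmul φ * f) ((x ⊗ₜ y) ⊗ₜ (z ⊗ₜ w)) = ∑ j, ∑ l, ∑ r,
      φ (y1 j) (z1 l) (w1 r) * f ((x ⊗ₜ y2 j) ⊗ₜ (z2 l ⊗ₜ w2 r)) := by
  obtain ⟨nx, x1, x2, hx⟩ := exists_sum_tmul_eq (comul (R := k) x)
  rw [convMul_tmul_tmul _ _ hx hy hz hw]
  conv_rhs => rw [← sum_counit_smul_right hx]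
  simp only [counitTmul_tmul, TensorProduct.sum_tmul, ← TensorProduct.smul_tmul', map_sum, map_smul,
    smul_eq_mul, Finset.mul_sum]
  rw [Finset.sum_comm]
  refine Fintype.sum_congr _ _ fun j => ?_
  rw [Finset.sum_comm]
  refine Fintype.sum_congr _ _ fun l => ?_
  rw [Finset.sum_comm]
  exact Fintype.sum_congr _ _ fun r => Fintype.sum_congr _ _ fun i => by ring

lemma ωMulRight_mul_ωMulLeft :
    B.ωMulRight * B.ωMulLeft = counitTmul B.ω * (B.ωMulMid * tmulCounit B.ω) := by
  ext x y z w
  obtain ⟨nx, x1, x2, hx⟩ := exists_sum_tmul_eq (comul (R := k) x)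
  obtain ⟨ny, y1, y2, hy⟩ := exists_sum_tmul_eq (comul (R := k) y)
  obtain ⟨nz, z1, z2, hz⟩ := exists_sum_tmul_eq (comul (R := k) z)
  obtain ⟨nw, w1, w2, hw⟩ := exists_sum_tmul_eq (comul (R := k) w)
  choose my y21 y22 hy2 using fun j => exists_sum_tmul_eq (comul (R := k) (y2 j))
  choose mz z21 z22 hz2 using fun l => exists_sum_tmul_eq (comul (R := k) (z2 l))
  have h := B.cocycle x y z w _ _ _ _ _ _ _ _ _ _ _ _ _ y21 y22 _ z21 z22 hx hy hz hw hy2 hz2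
  refine (convMul_tmul_tmul _ _ hx hy hz hw).trans <| .trans ?_
    (counitTmul_convMul B.ω _ x hy hz hw).symm
  simp only [convMul_tmulCounit B.ω _ _ hx (hy2 _) (hz2 _), ωMulRight_tmul, ωMulLeft_tmul, h,
    ωMulMid_tmul, Finset.mul_sum, mul_assoc]
  rw [Finset.sum_comm]
  refine Fintype.sum_congr _ _ fun j => ?_
  rw [Fintype.sum_congr _ _ fun i => Finset.sum_comm, Finset.sum_comm]
  refine Fintype.sum_congr _ _ fun l => ?_
  rw [Finset.sum_comm (s := (Finset.univ : Finset (Fin nw)))]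
  refine Fintype.sum_congr _ _ fun i => ?_
  rw [Finset.sum_comm (s := (Finset.univ : Finset (Fin nw)))]
  exact Fintype.sum_congr _ _ fun p => Finset.sum_comm

lemma ωMulRight_mul_ωMulLeft_mul :
    B.ωMulRight * (B.ωMulLeft * tmulCounit B.ωInv) = counitTmul B.ω * B.ωMulMid := by
  rw [← mul_assoc, ωMulRight_mul_ωMulLeft, mul_assoc, mul_assoc, tmulCounit_mul_tmulCounit_ωInv,
    _root_.mul_one]

/-- The map `h ↦ ∑ S(h₁) ⊗ h₂`. -/
noncomputable def leftLeg (S : H →ₗ[k] H) : H →ₗ[k] H ⊗[k] H := rTensor H S ∘ₗ comul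

/-- The map `h ↦ ∑ h₁ ⊗ S(h₂)`. -/
noncomputable def rightLeg (S : H →ₗ[k] H) : H →ₗ[k] H ⊗[k] H := lTensor H S ∘ₗ comul

/-- The map `z ⊗ w ↦ ∑ z₁w ⊗ z₂`. -/
noncomputable def comulMul : H ⊗[k] H →ₗ[k] H ⊗[k] H :=
  rTensor H B.mulT ∘ₗ (TensorProduct.rightComm k H H H).toLinearMap ∘ₗ rTensor H comul

/-- The map `y ⊗ z ↦ ∑ z₁ ⊗ yz₂`. -/
noncomputable def mulComul : H ⊗[k] H →ₗ[k] H ⊗[k] H :=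
  lTensor H B.mulT ∘ₗ (TensorProduct.leftComm k H H H).toLinearMap ∘ₗ lTensor H comul

variable {B} {S : H →ₗ[k] H}

lemma IsPreantipode.comulMul_leftLeg (hS : B.IsPreantipode S) (h : H) :
    B.comulMul (leftLeg S h) = B.one ⊗ₜ S h := by
  obtain ⟨n, a, b, hab⟩ := exists_sum_tmul_eq (comul (R := k) h)
  choose m c d hcd using fun i => exists_sum_tmul_eq (comul (R := k) (S (a i)))
  rw [← hS.1 h n a b m c d hab hcd]
  simp [leftLeg, comulMul, hab, hcd, TensorProduct.sum_tmul]

lemma IsPreantipode.mulComul_rightLeg (hS : B.IsPreantipode S) (h : H) :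
    B.mulComul (rightLeg S h) = S h ⊗ₜ B.one := by
  obtain ⟨n, a, b, hab⟩ := exists_sum_tmul_eq (comul (R := k) h)
  choose m c d hcd using fun i => exists_sum_tmul_eq (comul (R := k) (S (b i)))
  rw [← hS.2.1 h n a b m c d hab hcd]
  simp [rightLeg, mulComul, hab, hcd, TensorProduct.tmul_sum]

lemma IsPreantipode.triR_ω (hS : B.IsPreantipode S) (h : H) :
    triR B.ω (lTensor H (leftLeg S) (comul h)) = counit (R := k) h := by
  obtain ⟨n, a, b, hab⟩ := exists_sum_tmul_eq (comul (R := k) h)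
  choose m c d hcd using fun i => exists_sum_tmul_eq (comul (R := k) (b i))
  rw [← hS.2.2 h n a b m c d hab hcd]
  simp [leftLeg, hab, hcd, TensorProduct.tmul_sum]

lemma rTensor_mulT_comul (B : CoquasiBialgebra k H) (q : H ⊗[k] H) :
    rTensor (H ⊗[k] H) B.mulT (comul q) = TensorProduct.assoc k H H H
      (rTensor H B.comulMul ((TensorProduct.assoc k H H H).symm (lTensor H comul q))) := by
  induction q with
  | zero => simp
  | add p q hp hq => simp only [map_add, hp, hq]
  | tmul z w =>
    obtain ⟨n, z1, z2, hz⟩ := exists_sum_tmul_eq (comul (R := k) z)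
    obtain ⟨m, w1, w2, hw⟩ := exists_sum_tmul_eq (comul (R := k) w)
    rw [comul_tmul_eq_sum hz hw]
    simp [comulMul, hz, hw, TensorProduct.sum_tmul, TensorProduct.tmul_sum,
      Fintype.sum_prod_type_right]

lemma IsPreantipode.rTensor_mulT_comul_leftLeg (hS : B.IsPreantipode S) (h : H) :
    rTensor (H ⊗[k] H) B.mulT (comul (leftLeg S h)) = B.one ⊗ₜ leftLeg S h := by
  have hassoc : (TensorProduct.assoc k H H H).symm (lTensor H comul (leftLeg S h)) =
      rTensor H (leftLeg S) (comul h) := by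
    have hcomm : ∀ t : H ⊗[k] H,
        (TensorProduct.assoc k H H H).symm (lTensor H comul (rTensor H S t)) =
        rTensor H (rTensor H S) ((TensorProduct.assoc k H H H).symm (lTensor H comul t)) := by
      intro t
      induction t with
      | zero => simp
      | add p q hp hq => simp only [map_add, hp, hq]
      | tmul z w =>
        obtain ⟨m, w1, w2, hw⟩ := exists_sum_tmul_eq (comul (R := k) w)
        simp [hw, TensorProduct.tmul_sum]
    rw [leftLeg, comp_apply, hcomm, coassoc_symm_apply, rTensor_comp, comp_apply]
  rw [rTensor_mulT_comul, hassoc]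
  obtain ⟨n, a, b, hab⟩ := exists_sum_tmul_eq (comul (R := k) h)
  simp only [hab, map_sum, rTensor_tmul, hS.comulMul_leftLeg, TensorProduct.assoc_tmul]
  simp [leftLeg, hab, TensorProduct.tmul_sum]

lemma ωMulRight_convMul_of_rTensor_mulT_comul (B : CoquasiBialgebra k H)
    (f : WithConv ((H ⊗[k] H) ⊗[k] (H ⊗[k] H) →ₗ[k] k)) (p : H ⊗[k] H) {q : H ⊗[k] H}
    (hq : rTensor (H ⊗[k] H) B.mulT (comul q) = B.one ⊗ₜ q) :
    (B.ωMulRight * f) (p ⊗ₜ q) = f (p ⊗ₜ q) := by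
  obtain ⟨n, p1, p2, hp⟩ := exists_sum_tmul_eq (comul (R := k) p)
  obtain ⟨m, q1, q2, hpq⟩ := exists_sum_tmul_eq (comul (R := k) q)
  have hone : ∀ t : H ⊗[k] H, triL B.ω (t ⊗ₜ B.one) = counit (R := k) t := by
    intro t
    induction t with
    | zero => simp
    | add s t hs ht => simp only [TensorProduct.add_tmul, map_add, hs, ht]
    | tmul x y => simp [B.ω_one_right, mul_comm]
  have hterm : ∀ i, ∑ j, B.ωMulRight (p1 i ⊗ₜ q1 j) * f (p2 i ⊗ₜ q2 j) =
      counit (R := k) (p1 i) * f (p2 i ⊗ₜ q) := fun i => by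
    have := congr(mul' k k (TensorProduct.map (triL B.ω ∘ₗ TensorProduct.mk k _ H (p1 i))
      (f.ofConv ∘ₗ TensorProduct.mk k _ _ (p2 i)) $hq))
    simpa [hpq, hone, ωMulRight] using this
  rw [convMul_apply_eq_sum _ _ (comul_tmul_eq_sum hp hpq), Fintype.sum_prod_type]
  simp only [hterm]
  conv_rhs => rw [← sum_counit_smul_right hp]
  simp [TensorProduct.sum_tmul, ← TensorProduct.smul_tmul']

lemma ωMulLeft_convMul_of_rTensor_mulT_comul (B : CoquasiBialgebra k H)
    (f : WithConv ((H ⊗[k] H) ⊗[k] (H ⊗[k] H) →ₗ[k] k)) {p : H ⊗[k] H} (q : H ⊗[k] H)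
    (hp : rTensor (H ⊗[k] H) B.mulT (comul p) = B.one ⊗ₜ p) :
    (B.ωMulLeft * f) (p ⊗ₜ q) = f (p ⊗ₜ q) := by
  obtain ⟨n, p1, p2, hpp⟩ := exists_sum_tmul_eq (comul (R := k) p)
  obtain ⟨m, q1, q2, hq⟩ := exists_sum_tmul_eq (comul (R := k) q)
  have hone : ∀ t : H ⊗[k] H, triR B.ω (B.one ⊗ₜ t) = counit (R := k) t := by
    intro t
    induction t with
    | zero => simp
    | add s t hs ht => simp only [TensorProduct.tmul_add, map_add, hs, ht]
    | tmul x y => simp [B.ω_one_left, mul_comm]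
  have hterm : ∀ j, ∑ i, B.ωMulLeft (p1 i ⊗ₜ q1 j) * f (p2 i ⊗ₜ q2 j) =
      counit (R := k) (q1 j) * f (p ⊗ₜ q2 j) := fun j => by
    have := congr(mul' k k (TensorProduct.map
      (triR B.ω ∘ₗ (TensorProduct.mk k H (H ⊗[k] H)).flip (q1 j))
      (f.ofConv ∘ₗ (TensorProduct.mk k (H ⊗[k] H) (H ⊗[k] H)).flip (q2 j)) $hp))
    simpa [hpp, hone, ωMulLeft] using this
  rw [convMul_apply_eq_sum _ _ (comul_tmul_eq_sum hpp hq), Fintype.sum_prod_type_right]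
  simp only [hterm]
  conv_rhs => rw [← sum_counit_smul_right hq]
  simp [TensorProduct.tmul_sum]

lemma lTensor_mulT_comul (B : CoquasiBialgebra k H) (v : H ⊗[k] H) :
    lTensor (H ⊗[k] H) B.mulT (comul v) = (TensorProduct.assoc k H H H).symm
      (lTensor H B.mulComul (TensorProduct.assoc k H H H (rTensor H comul v))) := by
  induction v with
  | zero => simp
  | add p q hp hq => simp only [map_add, hp, hq]
  | tmul y z =>
    obtain ⟨n, y1, y2, hy⟩ := exists_sum_tmul_eq (comul (R := k) y)
    obtain ⟨m, z1, z2, hz⟩ := exists_sum_tmul_eq (comul (R := k) z)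
    rw [comul_tmul_eq_sum hy hz]
    simp [mulComul, hy, hz, TensorProduct.sum_tmul, TensorProduct.tmul_sum,
      Fintype.sum_prod_type]

lemma IsPreantipode.lTensor_mulT_comul_rightLeg (hS : B.IsPreantipode S) (h : H) :
    lTensor (H ⊗[k] H) B.mulT (comul (rightLeg S h)) = rightLeg S h ⊗ₜ B.one := by
  have hassoc : TensorProduct.assoc k H H H (rTensor H comul (rightLeg S h)) =
      lTensor H (rightLeg S) (comul h) := by
    have hcomm : ∀ t : H ⊗[k] H,
        TensorProduct.assoc k H H H (rTensor H comul (lTensor H S t)) =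
        lTensor H (lTensor H S) (TensorProduct.assoc k H H H (rTensor H comul t)) := by
      intro t
      induction t with
      | zero => simp
      | add p q hp hq => simp only [map_add, hp, hq]
      | tmul z w =>
        obtain ⟨m, z1, z2, hz⟩ := exists_sum_tmul_eq (comul (R := k) z)
        simp [hz, TensorProduct.sum_tmul]
    rw [rightLeg, comp_apply, hcomm, coassoc_apply, lTensor_comp, comp_apply]
  rw [lTensor_mulT_comul, hassoc]
  obtain ⟨n, a, b, hab⟩ := exists_sum_tmul_eq (comul (R := k) h)
  simp only [hab, map_sum, lTensor_tmul, hS.mulComul_rightLeg, TensorProduct.assoc_symm_tmul]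
  simp [rightLeg, hab, TensorProduct.sum_tmul]

lemma convMul_ωMulMid_of_lTensor_mulT_comul (B : CoquasiBialgebra k H)
    (f : WithConv ((H ⊗[k] H) ⊗[k] (H ⊗[k] H) →ₗ[k] k)) (x w : H) {v : H ⊗[k] H}
    (hv : lTensor (H ⊗[k] H) B.mulT (comul v) = v ⊗ₜ B.one) :
    (f * B.ωMulMid) (tmulMid x w v) = f (tmulMid x w v) := by
  obtain ⟨n, x1, x2, hx⟩ := exists_sum_tmul_eq (comul (R := k) x)
  obtain ⟨m, w1, w2, hw⟩ := exists_sum_tmul_eq (comul (R := k) w)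
  have key : ∀ u : H ⊗[k] H, (f * B.ωMulMid) (tmulMid x w u) = ∑ i, ∑ r, mul' k k
      (TensorProduct.map (f.ofConv ∘ₗ tmulMid (x1 i) (w1 r)) ((B.ω (x2 i)).flip (w2 r))
        (lTensor (H ⊗[k] H) B.mulT (comul u))) := by
    intro u
    induction u with
    | zero => simp
    | add p q hp hq => simp only [map_add, hp, hq, Finset.sum_add_distrib]
    | tmul y z =>
      obtain ⟨ny, y1, y2, hy⟩ := exists_sum_tmul_eq (comul (R := k) y)
      obtain ⟨nz, z1, z2, hz⟩ := exists_sum_tmul_eq (comul (R := k) z)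
      rw [tmulMid_tmul, convMul_tmul_tmul _ _ hx hy hz hw, comul_tmul_eq_sum hy hz]
      refine Fintype.sum_congr _ _ fun i => ?_
      rw [Fintype.sum_congr _ _ fun j => Finset.sum_comm, Finset.sum_comm]
      simp [Fintype.sum_prod_type]
  have hvx : tmulMid (k := k) x w v =
      ∑ i, ∑ r, (counit (R := k) (x2 i) * counit (R := k) (w2 r)) • tmulMid (x1 i) (w1 r) v := by
    conv_lhs => rw [← sum_counit_smul_left hx, ← sum_counit_smul_left hw]
    simp [tmulMid, mul_smul, Finset.smul_sum]
  rw [key, hv, hvx]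
  simp [B.ω_one, mul_comm]

section Leg

variable {n : ℕ} {a b : Fin n → H}

lemma sum_leftLeg_tmul_leftLeg {h : H} {m : Fin n → ℕ} {c d : ∀ i, Fin (m i) → H}
    (hab : comul (R := k) h = ∑ i, a i ⊗ₜ[k] b i)
    (hcd : ∀ i, comul (R := k) (b i) = ∑ p, c i p ⊗ₜ[k] d i p) :
    ∑ i, leftLeg S (a i) ⊗ₜ[k] leftLeg S (b i) =
      ∑ i, ∑ p, (S (a i) ⊗ₜ[k] c i p) ⊗ₜ[k] leftLeg S (d i p) := by
  have hassoc : ∀ t : (H ⊗[k] H) ⊗[k] H,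
      (TensorProduct.assoc k H H (H ⊗[k] H)).symm (TensorProduct.map S (lTensor H (leftLeg S))
        (TensorProduct.assoc k H H H t)) = TensorProduct.map (rTensor H S) (leftLeg S) t := by
    intro t
    induction t with
    | zero => simp
    | add p q hp hq => simp only [map_add, hp, hq]
    | tmul u w =>
      induction u with
      | zero => simp
      | add p q hp hq => simp only [TensorProduct.add_tmul, map_add, hp, hq]
      | tmul y z => simp
  have := hassoc (rTensor H comul (comul h))
  rw [coassoc_apply] at this
  simpa [hab, hcd, TensorProduct.tmul_sum, leftLeg] using this.symm

lemma sum_tmulMid_rightLeg (x : H) {h : H} (hab : comul (R := k) h = ∑ i, a i ⊗ₜ[k] b i) :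
    ∑ i, tmulMid x (b i) (rightLeg S (a i)) = ∑ i, (x ⊗ₜ[k] a i) ⊗ₜ[k] leftLeg S (b i) := by
  have hassoc : ∀ t : (H ⊗[k] H) ⊗[k] H,
      (TensorProduct.assoc k H H (H ⊗[k] H)).symm (x ⊗ₜ lTensor H (rTensor H S)
        (TensorProduct.assoc k H H H t)) = (TensorProduct.assoc k H H (H ⊗[k] H)).symm
          (x ⊗ₜ TensorProduct.assoc k H H H (rTensor H (lTensor H S) t)) := by
    intro t
    induction t with
    | zero => simp
    | add p q hp hq => simp only [map_add, TensorProduct.tmul_add, hp, hq]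
    | tmul u w =>
      induction u with
      | zero => simp
      | add p q hp hq => simp only [TensorProduct.add_tmul, TensorProduct.tmul_add, map_add, hp, hq]
      | tmul y z => simp
  have := hassoc (rTensor H comul (comul h))
  rw [coassoc_apply] at this
  simpa [hab, TensorProduct.tmul_sum, leftLeg, rightLeg, tmulMid] using this.symm

end Leg

lemma tmulCounit_tmul_leftLeg (φ : H →ₗ[k] H →ₗ[k] H →ₗ[k] k) (x y h : H) :
    (tmulCounit φ).ofConv ((x ⊗ₜ y) ⊗ₜ leftLeg S h) = φ x y (S h) := by
  obtain ⟨n, a, b, hab⟩ := exists_sum_tmul_eq (comul (R := k) h)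
  conv_rhs => rw [← sum_counit_smul_left hab]
  simp [leftLeg, hab, TensorProduct.tmul_sum, mul_comm]

lemma counitTmul_tmul_leftLeg (φ : H →ₗ[k] H →ₗ[k] H →ₗ[k] k) (x y h : H) :
    (counitTmul φ).ofConv ((x ⊗ₜ y) ⊗ₜ leftLeg S h) =
      counit (R := k) x * triR φ (y ⊗ₜ leftLeg S h) := by
  simp [counitTmul]

lemma IsPreantipode.sum_ωInv (hS : B.IsPreantipode S) {h : H} {n : ℕ} {a b : Fin n → H}
    {m : Fin n → ℕ} {c d : ∀ i, Fin (m i) → H}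
    (hab : comul (R := k) h = ∑ i, a i ⊗ₜ[k] b i)
    (hcd : ∀ i, comul (R := k) (b i) = ∑ p, c i p ⊗ₜ[k] d i p) :
    ∑ i, ∑ p, B.ωInv (S (a i)) (c i p) (S (d i p)) = counit (R := k) (S h) := by
  have hω : ∀ i, ∑ p, triR B.ω (c i p ⊗ₜ leftLeg S (d i p)) = counit (R := k) (b i) := fun i => by
    simpa [hcd] using hS.triR_ω (b i)
  calc ∑ i, ∑ p, B.ωInv (S (a i)) (c i p) (S (d i p))
      = tmulCounit B.ωInv (∑ i, leftLeg S (a i) ⊗ₜ[k] leftLeg S (b i)) := by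
        simp only [sum_leftLeg_tmul_leftLeg hab hcd, map_sum, tmulCounit_tmul_leftLeg]
    _ = (B.ωMulRight * (B.ωMulLeft * tmulCounit B.ωInv))
          (∑ i, leftLeg S (a i) ⊗ₜ[k] leftLeg S (b i)) := by
        simp only [map_sum, ωMulRight_convMul_of_rTensor_mulT_comul B _ _
          (hS.rTensor_mulT_comul_leftLeg _), ωMulLeft_convMul_of_rTensor_mulT_comul B _ _
          (hS.rTensor_mulT_comul_leftLeg _)]
    _ = counitTmul B.ω (∑ i, ∑ p, tmulMid (S (a i)) (d i p) (rightLeg S (c i p))) := by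
        rw [ωMulRight_mul_ωMulLeft_mul, sum_leftLeg_tmul_leftLeg hab hcd]
        simp only [← sum_tmulMid_rightLeg _ (hcd _), map_sum,
          convMul_ωMulMid_of_lTensor_mulT_comul B _ _ _ (hS.lTensor_mulT_comul_rightLeg _)]
    _ = ∑ i, counit (R := k) (S (a i)) * counit (R := k) (b i) := by
        simp only [sum_tmulMid_rightLeg _ (hcd _), map_sum, counitTmul_tmul_leftLeg,
          ← Finset.mul_sum, hω]
    _ = counit (R := k) (S h) := by
        conv_rhs => rw [← sum_counit_smul_left hab]
        simp [mul_comm]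

end
end CoquasiBialgebra

/-- Let `k` be a field and `H` a coquasi-bialgebra over `k` with
preantipode `S`.  Then `∑ ω⁻¹(S(h₁) ⊗ h₂ ⊗ S(h₃)) = ε(S(h))` for every `h ∈ H`. -/
theorem ωInv_preantipode {k H : Type*} [Field k]
    [AddCommGroup H] [Module k H] [Coalgebra k H]
    (B : CoquasiBialgebra k H) (S : H →ₗ[k] H) (hS : B.IsPreantipode S)
    (h : H) (n : ℕ) (a b : Fin n → H) (m : Fin n → ℕ) (c d : ∀ i, Fin (m i) → H)
    (hrep : Coalgebra.comul (R := k) h = ∑ i, a i ⊗ₜ[k] b i)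
    (hrep2 : ∀ i, Coalgebra.comul (R := k) (b i) = ∑ p, c i p ⊗ₜ[k] d i p) :
    ∑ i, ∑ p, B.ωInv (S (a i)) (c i p) (S (d i p)) =
      Coalgebra.counit (R := k) (S h) :=
  hS.sum_ωInv hrep hrep2
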